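/- The monodromy matrix of the XYZ chain satisfies the global Yang–Baxter equation: for all λ, μ ∈ ℂ, R(λ,μ)·(T(λ) ⊗ T(μ)) = (T(μ) ⊗ T(λ))·R(λ,μ), as an identity of 4×4 matrices with entries operators on (ℂ²)^{⊗L}. -/

import Mathlib

open Complex Matrix Finset
open scoped Kronecker

noncomputable section

/-- Jacobi theta function `θ₁(z|τ) = -i ∑_{n∈ℤ} (-1)^n exp(πi(n+1/2)²τ + (2n+1)iz)`. -/
def theta1 (z τ : ℂ) : ℂ :=
  ∑' n : ℤ, -Complex.I * (-1 : ℂ) ^ n *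
    Complex.exp ((Real.pi : ℂ) * Complex.I * ((n : ℂ) + 1 / 2) ^ 2 * τ +
      (2 * (n : ℂ) + 1) * Complex.I * z)

/-- Jacobi theta function `θ₄(z|τ) = ∑_{n∈ℤ} (-1)^n exp(πin²τ + 2inz)`. -/
def theta4 (z τ : ℂ) : ℂ :=
  ∑' n : ℤ, (-1 : ℂ) ^ n *
    Complex.exp ((Real.pi : ℂ) * Complex.I * (n : ℂ) ^ 2 * τ +
      2 * (n : ℂ) * Complex.I * z)

/-- `H(μ) = θ₁(πμ/2K | iK'/K)`, the Jacobi theta function with quasi-periods 2K, 2iK'. -/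
def HJ (K K' μ : ℂ) : ℂ := theta1 ((Real.pi : ℂ) * μ / (2 * K)) (Complex.I * K' / K)

/-- `Θ(μ) = θ₄(πμ/2K | iK'/K)`. -/
def ΘJ (K K' μ : ℂ) : ℂ := theta4 ((Real.pi : ℂ) * μ / (2 * K)) (Complex.I * K' / K)

/-- `g(μ) = H(μ)Θ(μ)`. -/
def gJ (K K' μ : ℂ) : ℂ := HJ K K' μ * ΘJ K K' μ

/-- `h(μ) = g(μ)Θ(0)`. -/
def hJ (K K' μ : ℂ) : ℂ := gJ K K' μ * ΘJ K K' 0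

/-- `τ_k = (s+t)/2 + 2kη − K`. -/
def τJ (K η s t : ℂ) (k : ℤ) : ℂ := (s + t) / 2 + 2 * (k : ℂ) * η - K

/-- `α(λ,μ) = h(λ−μ−2η)/h(λ−μ)`. -/
def αJ (K K' η lam mu : ℂ) : ℂ := hJ K K' (lam - mu - 2 * η) / hJ K K' (lam - mu)

/-- `β_k(λ,μ) = (h(2η)/h(μ−λ))·(h(τ_k+μ−λ)/h(τ_k))`. -/
def βJ (K K' η s t : ℂ) (k : ℤ) (lam mu : ℂ) : ℂ :=
  hJ K K' (2 * η) / hJ K K' (mu - lam) *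
    (hJ K K' (τJ K η s t k + mu - lam) / hJ K K' (τJ K η s t k))

/-- Pauli matrices. -/
def σx : Matrix (Fin 2) (Fin 2) ℂ := !![0, 1; 1, 0]
def σy : Matrix (Fin 2) (Fin 2) ℂ := !![0, -Complex.I; Complex.I, 0]
def σz : Matrix (Fin 2) (Fin 2) ℂ := !![1, 0; 0, -1]

/-- `w₄+w₃ = Θ(2η)Θ(μ−η)H(μ+η)` etc. -/
def w4p3 (K K' η μ : ℂ) : ℂ := ΘJ K K' (2 * η) * ΘJ K K' (μ - η) * HJ K K' (μ + η)
def w4m3 (K K' η μ : ℂ) : ℂ := ΘJ K K' (2 * η) * HJ K K' (μ - η) * ΘJ K K' (μ + η)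
def w1p2 (K K' η μ : ℂ) : ℂ := HJ K K' (2 * η) * ΘJ K K' (μ - η) * ΘJ K K' (μ + η)
def w1m2 (K K' η μ : ℂ) : ℂ := HJ K K' (2 * η) * HJ K K' (μ - η) * HJ K K' (μ + η)
def wc4 (K K' η μ : ℂ) : ℂ := (w4p3 K K' η μ + w4m3 K K' η μ) / 2
def wc3 (K K' η μ : ℂ) : ℂ := (w4p3 K K' η μ - w4m3 K K' η μ) / 2
def wc1 (K K' η μ : ℂ) : ℂ := (w1p2 K K' η μ + w1m2 K K' η μ) / 2
def wc2 (K K' η μ : ℂ) : ℂ := (w1p2 K K' η μ - w1m2 K K' η μ) / 2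

/-- The single-site `L`-operator, a 2×2 matrix in auxiliary space whose entries are
operators (2×2 matrices) on the site Hilbert space ℂ². -/
def Lsite (K K' η μ : ℂ) : Matrix (Fin 2) (Fin 2) (Matrix (Fin 2) (Fin 2) ℂ) :=
  !![wc4 K K' η μ • (1 : Matrix (Fin 2) (Fin 2) ℂ) + wc3 K K' η μ • σz,
      wc1 K K' η μ • σx - (Complex.I * wc2 K K' η μ) • σy;
      wc1 K K' η μ • σx + (Complex.I * wc2 K K' η μ) • σy,
      wc4 K K' η μ • (1 : Matrix (Fin 2) (Fin 2) ℂ) - wc3 K K' η μ • σz]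

/-- Entries of the R-matrix. -/
def aJ (K K' η lam mu : ℂ) : ℂ := ΘJ K K' (2*η) * ΘJ K K' (lam - mu) * HJ K K' (lam - mu + 2*η)
def bJ (K K' η lam mu : ℂ) : ℂ := HJ K K' (2*η) * ΘJ K K' (lam - mu) * ΘJ K K' (lam - mu + 2*η)
def cJ (K K' η lam mu : ℂ) : ℂ := ΘJ K K' (2*η) * HJ K K' (lam - mu) * ΘJ K K' (lam - mu + 2*η)
def dJ (K K' η lam mu : ℂ) : ℂ := HJ K K' (2*η) * HJ K K' (lam - mu) * HJ K K' (lam - mu + 2*η)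

/-- The 4×4 R-matrix, with rows/columns indexed by `Fin 2 × Fin 2`
(the basis order (0,0),(0,1),(1,0),(1,1) corresponds to rows 1,2,3,4):
nonzero entries R₁₁ = R₄₄ = a, R₂₂ = R₃₃ = b, R₂₃ = R₃₂ = c, R₁₄ = R₄₁ = d. -/
def Rc (K K' η lam mu : ℂ) : Matrix (Fin 2 × Fin 2) (Fin 2 × Fin 2) ℂ :=
  Matrix.of fun p q =>
    if p = q then (if p.1 = p.2 then aJ K K' η lam mu else bJ K K' η lam mu)
    else if q = (p.2, p.1) ∧ p.1 ≠ p.2 then cJ K K' η lam mu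
    else if p.1 = p.2 ∧ q.1 = q.2 then dJ K K' η lam mu
    else 0

/-- Spin configurations of a chain of length L: the index set of the basis of (ℂ²)^{⊗L}. -/
abbrev Conf (L : ℕ) := Fin L → Fin 2

/-- Operators on (ℂ²)^{⊗L}. -/
abbrev OpC (L : ℕ) := Matrix (Conf L) (Conf L) ℂ

/-- Embedding of a one-site operator at site `n` of the chain (identity elsewhere). -/
def embed (L : ℕ) (n : Fin L) (A : Matrix (Fin 2) (Fin 2) ℂ) : OpC L :=
  Matrix.of fun f g => A (f n) (g n) * ∏ m ∈ univ.erase n, if f m = g m then 1 else 0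

/-- The `L`-operator at site `n`, entries acting on (ℂ²)^{⊗L}. -/
def Lop (K K' η : ℂ) (L : ℕ) (n : Fin L) (μ : ℂ) : Matrix (Fin 2) (Fin 2) (OpC L) :=
  (Lsite K K' η μ).map (embed L n)

/-- The monodromy matrix `T(μ) = L_L(μ)···L_1(μ)` (site n = i+1 for `i : Fin L`). -/
def Tm (K K' η : ℂ) (L : ℕ) (μ : ℂ) : Matrix (Fin 2) (Fin 2) (OpC L) :=
  (List.ofFn fun i : Fin L => Lop K K' η L i.rev μ).prod

def Amat (K K' η : ℂ) (L : ℕ) (μ : ℂ) : OpC L := Tm K K' η L μ 0 0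
def Bmat (K K' η : ℂ) (L : ℕ) (μ : ℂ) : OpC L := Tm K K' η L μ 0 1
def Cmat (K K' η : ℂ) (L : ℕ) (μ : ℂ) : OpC L := Tm K K' η L μ 1 0
def Dmat (K K' η : ℂ) (L : ℕ) (μ : ℂ) : OpC L := Tm K K' η L μ 1 1

/-- The gauge matrix `M_k(μ)`. -/
def Mg (K K' η s t : ℂ) (k : ℤ) (μ : ℂ) : Matrix (Fin 2) (Fin 2) ℂ :=
  !![HJ K K' (s + 2 * (k : ℂ) * η - μ), (gJ K K' (τJ K η s t k))⁻¹ * HJ K K' (t + 2 * (k : ℂ) * η + μ);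
     ΘJ K K' (s + 2 * (k : ℂ) * η - μ), (gJ K K' (τJ K η s t k))⁻¹ * ΘJ K K' (t + 2 * (k : ℂ) * η + μ)]

/-- View a scalar 2×2 matrix as a 2×2 matrix of operators on (ℂ²)^{⊗L}. -/
def toOp (L : ℕ) (A : Matrix (Fin 2) (Fin 2) ℂ) : Matrix (Fin 2) (Fin 2) (OpC L) :=
  A.map fun z => z • (1 : OpC L)

/-- View a scalar 2×2 matrix as a 2×2 matrix of one-site operators. -/
def toOp2 (A : Matrix (Fin 2) (Fin 2) ℂ) : Matrix (Fin 2) (Fin 2) (Matrix (Fin 2) (Fin 2) ℂ) :=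
  A.map fun z => z • (1 : Matrix (Fin 2) (Fin 2) ℂ)

/-- The gauge-transformed monodromy matrix `T_{k,l}(μ) = M_k(μ)⁻¹ T(μ) M_l(μ)`. -/
def Tg (K K' η s t : ℂ) (L : ℕ) (k l : ℤ) (μ : ℂ) : Matrix (Fin 2) (Fin 2) (OpC L) :=
  toOp L (Mg K K' η s t k μ)⁻¹ * Tm K K' η L μ * toOp L (Mg K K' η s t l μ)

def Ag (K K' η s t : ℂ) (L : ℕ) (k l : ℤ) (μ : ℂ) : OpC L := Tg K K' η s t L k l μ 0 0
def Bg (K K' η s t : ℂ) (L : ℕ) (k l : ℤ) (μ : ℂ) : OpC L := Tg K K' η s t L k l μ 0 1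
def Cg (K K' η s t : ℂ) (L : ℕ) (k l : ℤ) (μ : ℂ) : OpC L := Tg K K' η s t L k l μ 1 0
def Dg (K K' η s t : ℂ) (L : ℕ) (k l : ℤ) (μ : ℂ) : OpC L := Tg K K' η s t L k l μ 1 1

/-- The gauge-transformed one-site L-operator `L_n^l(μ) = M_{n+l}(μ)⁻¹ L_n(μ) M_{n+l−1}(μ)`. -/
def Lg (K K' η s t : ℂ) (n l : ℤ) (μ : ℂ) : Matrix (Fin 2) (Fin 2) (Matrix (Fin 2) (Fin 2) ℂ) :=
  toOp2 (Mg K K' η s t (n + l) μ)⁻¹ * Lsite K K' η μ * toOp2 (Mg K K' η s t (n + l - 1) μ)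

/-- The local vacuum `|ω_n^l⟩` (depending on n, l only through nl = n + l):
`H(s+(2(n+l)−1)η)|↑⟩ + Θ(s+(2(n+l)−1)η)|↓⟩`. -/
def ωvec (K K' η s : ℂ) (nl : ℤ) : Fin 2 → ℂ :=
  ![HJ K K' (s + (2 * (nl : ℂ) - 1) * η), ΘJ K K' (s + (2 * (nl : ℂ) - 1) * η)]

/-- The dual local vacuum `⟨ω_n^l| = Θ(t+(2(n+l)−1)η)⟨↑| − H(t+(2(n+l)−1)η)⟨↓|`. -/
def ωdual (K K' η t : ℂ) (nl : ℤ) : Fin 2 → ℂ :=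
  ![ΘJ K K' (t + (2 * (nl : ℂ) - 1) * η), -HJ K K' (t + (2 * (nl : ℂ) - 1) * η)]

/-- The generating vector `|l⟩ = |ω_L^l⟩⊗···⊗|ω_1^l⟩` (site n = i+1). -/
def genV (K K' η s : ℂ) (L : ℕ) (l : ℤ) : Conf L → ℂ :=
  fun f => ∏ i : Fin L, ωvec K K' η s ((i : ℕ) + 1 + l) (f i)

/-- The dual generating vector `⟨l| = ⟨ω_1^l|⊗···⊗⟨ω_L^l|`. -/
def genD (K K' η t : ℂ) (L : ℕ) (l : ℤ) : Conf L → ℂ :=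
  fun f => ∏ i : Fin L, ωdual K K' η t ((i : ℕ) + 1 + l) (f i)

/-- The n-particle Bethe vector
`|Ψ_l^n(λ₁,…,λ_n)⟩ = B_{l+N−n+1,l−N+n−1}(λ₁)···B_{l+N,l−N}(λ_n)|l−N⟩`
(for n = N this is `|Ψ_l(λ₁,…,λ_N)⟩ = B_{l+1,l−1}(λ₁)···B_{l+N,l−N}(λ_N)|l−N⟩`). -/
def psiB (K K' η s t : ℂ) (L N n : ℕ) (l : ℤ) (lam : Fin n → ℂ) : Conf L → ℂ :=
  ((List.ofFn fun j : Fin n =>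
      Bg K K' η s t L (l + (N : ℤ) - (n : ℤ) + 1 + (j : ℕ)) (l - (N : ℤ) + (n : ℤ) - 1 - (j : ℕ))
        (lam j)).prod).mulVec
    (genV K K' η s L (l - (N : ℤ)))

/-- The dual n-particle Bethe vector
`⟨Ψ_l^n(λ₁,…,λ_n)| = ⟨l−N+1| C_{l+N−1,l−N+1}(λ_n)···C_{l+N−n,l−N+n}(λ₁)`. -/
def psiC (K K' η s t : ℂ) (L N n : ℕ) (l : ℤ) (lam : Fin n → ℂ) : Conf L → ℂ :=
  Matrix.vecMul (genD K K' η t L (l - (N : ℤ) + 1))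
    ((List.ofFn fun j : Fin n =>
        Cg K K' η s t L (l + (N : ℤ) - 1 - (j : ℕ)) (l - (N : ℤ) + 1 + (j : ℕ))
          (lam j.rev)).prod)

/-- `r(λ) = (h(λ+η)/h(λ−η))^L`. -/
def rJ (K K' η : ℂ) (L : ℕ) (lam : ℂ) : ℂ := (hJ K K' (lam + η) / hJ K K' (lam - η)) ^ L

/-- The eigenvalue `Λ_m(μ;{λ_k})`. -/
def ΛJ (K K' η : ℂ) (L Q m : ℕ) {n : ℕ} (lam : Fin n → ℂ) (μ : ℂ) : ℂ :=
  Complex.exp (2 * (Real.pi : ℂ) * Complex.I * (m : ℂ) / (Q : ℂ)) *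
      ((hJ K K' (μ + η)) ^ L * ∏ k, αJ K K' η μ (lam k)) +
    Complex.exp (-(2 * (Real.pi : ℂ) * Complex.I * (m : ℂ) / (Q : ℂ))) *
      ((hJ K K' (μ - η)) ^ L * ∏ k, αJ K K' η (lam k) μ)

/-- The sum of norms of the Bethe vectors
`M_n(λ₁,…,λ_n) = (1/Q) Σ_{l=0}^{Q−1} ⟨Ψ_l^n(λ)|Ψ_l^n(λ)⟩`. -/
def MnS (K K' η s t : ℂ) (Q L N n : ℕ) (lam : Fin n → ℂ) : ℂ :=
  (Q : ℂ)⁻¹ * ∑ l ∈ Finset.range Q,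
    dotProduct (psiC K K' η s t L N n (l : ℤ) lam) (psiB K K' η s t L N n (l : ℤ) lam)

/-- `c_L = ⟨l|l−1⟩` (evaluated at l = 0, being independent of l). -/
def cLJ (K K' η s t : ℂ) (L : ℕ) : ℂ :=
  dotProduct (genD K K' η t L 0) (genV K K' η s L (-1))

/-- The eigenvector `|Φ_m⟩ = (1/√Q) Σ_{l=0}^{Q−1} e^{2πilm/Q} |Ψ_l⟩`. -/
def PhiV (K K' η s t : ℂ) (Q L N m : ℕ) (lam : Fin N → ℂ) : Conf L → ℂ :=
  ((Real.sqrt Q : ℝ) : ℂ)⁻¹ • ∑ l ∈ Finset.range Q,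
    Complex.exp (2 * (Real.pi : ℂ) * Complex.I * (l : ℂ) * (m : ℂ) / (Q : ℂ)) •
      psiB K K' η s t L N N (l : ℤ) lam

/-- The dual eigenvector `⟨Φ_m| = (1/√Q) Σ_{l=0}^{Q−1} e^{−2πilm/Q} ⟨Ψ_l|`. -/
def PhiD (K K' η s t : ℂ) (Q L N m : ℕ) (lam : Fin N → ℂ) : Conf L → ℂ :=
  ((Real.sqrt Q : ℝ) : ℂ)⁻¹ • ∑ l ∈ Finset.range Q,
    Complex.exp (-(2 * (Real.pi : ℂ) * Complex.I * (l : ℂ) * (m : ℂ) / (Q : ℂ))) •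
      psiC K K' η s t L N N (l : ℤ) lam

/-- `φ_k = log( r(λ_k) ∏_{i≠k} α(λ_k,λ_i)/α(λ_i,λ_k) )`. -/
def phiG (K K' η : ℂ) (L : ℕ) {n : ℕ} (lam : Fin n → ℂ) (k : Fin n) : ℂ :=
  Complex.log (rJ K K' η L (lam k) *
    ∏ i ∈ univ.erase k, αJ K K' η (lam k) (lam i) / αJ K K' η (lam i) (lam k))



section Helpers

/- ### Theta function identities -/

theorem ybe_jt_summable (τ : ℂ) (hτ : 0 < τ.im) (w : ℂ) :
    Summable fun n : ℤ => Complex.exp (2 * Real.pi * Complex.I * n * w + Real.pi * Complex.I * n ^ 2 * τ) :=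
  (summable_jacobiTheta₂_term_iff w τ).2 hτ

theorem ybe_int_summable (τ : ℂ) (hτ : 0 < τ.im) (z : ℂ) :
    Summable fun n : ℤ => Complex.exp ((Real.pi : ℂ) * Complex.I * (n : ℂ) ^ 2 * τ +
      2 * (n : ℂ) * Complex.I * z) := by
  refine (ybe_jt_summable τ hτ (z / Real.pi)).congr fun n => ?_
  have : (Real.pi : ℂ) ≠ 0 := by exact_mod_cast Real.pi_ne_zero
  congr 1
  field_simp
  ring

theorem ybe_half_summable (τ : ℂ) (hτ : 0 < τ.im) (z : ℂ) :
    Summable fun n : ℤ => Complex.exp ((Real.pi : ℂ) * Complex.I * ((n : ℂ) + 1 / 2) ^ 2 * τ +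
      (2 * (n : ℂ) + 1) * Complex.I * z) := by
  refine ((ybe_int_summable τ hτ (z + Real.pi * τ / 2)).mul_left
    (Complex.exp (Real.pi * Complex.I * τ / 4 + Complex.I * z))).congr fun n => ?_
  rw [← Complex.exp_add]
  congr 1
  ring

def ybeA (τ z : ℂ) : ℂ := ∑' n : ℤ, Complex.exp ((Real.pi : ℂ) * Complex.I * (n : ℂ) ^ 2 * (2 * τ) +
      2 * (n : ℂ) * Complex.I * z)

def ybeB (τ z : ℂ) : ℂ := ∑' n : ℤ,
    Complex.exp ((Real.pi : ℂ) * Complex.I * ((n : ℂ) + 1 / 2) ^ 2 * (2 * τ) +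
      (2 * (n : ℂ) + 1) * Complex.I * z)

def ybeEquiv : (ℤ × ℤ) ⊕ (ℤ × ℤ) ≃ ℤ × ℤ where
  toFun := Sum.elim (fun p => (p.1 + p.2, p.1 - p.2)) (fun p => (p.1 + p.2, p.1 - p.2 - 1))
  invFun q := if (q.1 + q.2) % 2 = 0 then Sum.inl ((q.1 + q.2) / 2, (q.1 - q.2) / 2)
    else Sum.inr ((q.1 + q.2 + 1) / 2, (q.1 - q.2 - 1) / 2)
  left_inv := by
    rintro (⟨a, b⟩ | ⟨a, b⟩)
    · have : (a + b + (a - b)) % 2 = 0 := by omega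
      simp only [Sum.elim_inl, this, if_true]
      congr 2 <;> omega
    · have : ¬ (a + b + (a - b - 1)) % 2 = 0 := by omega
      simp only [Sum.elim_inr, this, if_false]
      congr 2 <;> omega
  right_inv := by
    rintro ⟨a, b⟩
    by_cases h : (a + b) % 2 = 0
    · simp only [h, if_true, Sum.elim_inl, Prod.mk.injEq]
      constructor <;> omega
    · simp only [h, if_false, Sum.elim_inr, Prod.mk.injEq]
      constructor <;> omega

theorem ybe_split (F G : ℤ → ℂ) (hF : Summable F) (hG : Summable G) (P P' Q Q' : ℤ → ℂ)
    (hP : Summable P) (hP' : Summable P') (hQ : Summable Q) (hQ' : Summable Q')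
    (h1 : ∀ N M : ℤ, F (N + M) * G (N - M) = P N * P' M)
    (h2 : ∀ N M : ℤ, F (N + M) * G (N - M - 1) = Q N * Q' M) :
    (∑' n, F n) * (∑' n, G n) = (∑' n, P n) * (∑' n, P' n) + (∑' n, Q n) * (∑' n, Q' n) := by
  have key : ∀ f g : ℤ → ℂ, Summable f → Summable g →
      HasSum (fun p : ℤ × ℤ => f p.1 * g p.2) ((∑' n, f n) * ∑' n, g n) := fun f g hf hg =>
    hf.hasSum.mul hg.hasSum (summable_mul_of_summable_norm hf.norm hg.norm)
  have e1 := key F G hF hG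
  rw [← ybeEquiv.hasSum_iff] at e1
  refine e1.unique (HasSum.sum ?_ ?_)
  · convert key P P' hP hP' using 2 with p
    exact h1 p.1 p.2
  · convert key Q Q' hQ hQ' using 2 with p
    exact h2 p.1 p.2

theorem ybe_sgn (n : ℤ) : (-1 : ℂ) ^ n = Complex.exp (Real.pi * Complex.I * n) := by
  rw [mul_comm _ (n : ℂ), Complex.exp_int_mul, Complex.exp_pi_mul_I]

theorem ybe_im2 (τ : ℂ) (hτ : 0 < τ.im) : 0 < (2 * τ).im := by
  simpa using hτ

theorem ybe_sgn_even (N M : ℤ) : (-1 : ℂ) ^ (N + M) * (-1 : ℂ) ^ (N - M) = 1 := by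
  rw [← zpow_add₀ (by norm_num), show N + M + (N - M) = 2 * N by ring, _root_.zpow_mul]; norm_num

theorem ybe_sgn_odd (N M : ℤ) : (-1 : ℂ) ^ (N + M) * (-1 : ℂ) ^ (N - M - 1) = -1 := by
  rw [← zpow_add₀ (by norm_num), show N + M + (N - M - 1) = 2 * N + (-1) by ring,
    zpow_add₀ (by norm_num), _root_.zpow_mul]; norm_num

theorem ybe_sgn_summable (f : ℤ → ℂ) (hf : Summable f) (c : ℂ) :
    Summable fun n : ℤ => c * (-1 : ℂ) ^ n * f n := by
  refine Summable.of_norm ?_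
  refine ((hf.norm.mul_left ‖c‖)).congr fun n => ?_
  simp

theorem ybeB_shift (τ z : ℂ) : ybeB τ z = ∑' n : ℤ,
    Complex.exp ((Real.pi : ℂ) * Complex.I * ((n : ℂ) - 1 / 2) ^ 2 * (2 * τ) +
      (2 * (n : ℂ) - 1) * Complex.I * z) := by
  unfold ybeB
  rw [← (Equiv.addRight (1 : ℤ)).tsum_eq (fun n : ℤ =>
    Complex.exp ((Real.pi : ℂ) * Complex.I * ((n : ℂ) - 1 / 2) ^ 2 * (2 * τ) +
      (2 * (n : ℂ) - 1) * Complex.I * z))]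
  refine tsum_congr fun n => ?_
  simp only [Equiv.coe_addRight]
  push_cast
  congr 1
  ring

theorem ybe_halfm_summable (τ : ℂ) (hτ : 0 < τ.im) (z : ℂ) :
    Summable fun n : ℤ => Complex.exp ((Real.pi : ℂ) * Complex.I * ((n : ℂ) - 1 / 2) ^ 2 * τ +
      (2 * (n : ℂ) - 1) * Complex.I * z) := by
  refine (((Equiv.subRight (1 : ℤ)).summable_iff).2 (ybe_half_summable τ hτ z)).congr fun n => ?_
  simp only [Equiv.subRight_apply, Function.comp]
  push_cast
  congr 1
  ring

theorem ybe_t4t4 (τ : ℂ) (hτ : 0 < τ.im) (x y : ℂ) :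
    theta4 x τ * theta4 y τ =
      ybeA τ (x + y) * ybeA τ (x - y) - ybeB τ (x + y) * ybeB τ (x - y) := by
  have h2 := ybe_im2 τ hτ
  rw [ybeB_shift τ (x + y), sub_eq_add_neg, ← neg_mul, ← tsum_neg]
  refine ybe_split _ _ ?_ ?_ _ _ _ _ (ybe_int_summable _ h2 _) (ybe_int_summable _ h2 _)
    (ybe_halfm_summable _ h2 _).neg (ybe_half_summable _ h2 _) ?_ ?_
  · simpa using ybe_sgn_summable _ (ybe_int_summable _ hτ x) 1
  · simpa using ybe_sgn_summable _ (ybe_int_summable _ hτ y) 1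
  · intro N M
    rw [mul_mul_mul_comm, ybe_sgn_even, one_mul, ← Complex.exp_add, ← Complex.exp_add]
    push_cast
    congr 1
    ring
  · intro N M
    rw [mul_mul_mul_comm, ybe_sgn_odd, neg_one_mul, neg_mul, ← Complex.exp_add, ← Complex.exp_add]
    push_cast
    congr 2
    ring

theorem ybe_t1t1 (τ : ℂ) (hτ : 0 < τ.im) (x y : ℂ) :
    theta1 x τ * theta1 y τ =
      ybeA τ (x + y) * ybeB τ (x - y) - ybeB τ (x + y) * ybeA τ (x - y) := by
  have h2 := ybe_im2 τ hτ
  rw [sub_eq_neg_add, ← neg_mul]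
  conv_rhs => rw [ybeB, ← tsum_neg]
  refine ybe_split _ _ ?_ ?_ _ _ _ _
    (ybe_half_summable _ h2 _).neg (ybe_int_summable _ h2 _)
    (ybe_int_summable _ h2 _) (ybe_half_summable _ h2 _) ?_ ?_
  · exact ybe_sgn_summable _ (ybe_half_summable _ hτ x) _
  · exact ybe_sgn_summable _ (ybe_half_summable _ hτ y) _
  · intro N M
    rw [mul_mul_mul_comm, mul_mul_mul_comm (-Complex.I), ybe_sgn_even, neg_mul_neg,
      Complex.I_mul_I, mul_one, neg_one_mul, neg_mul, ← Complex.exp_add, ← Complex.exp_add]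
    push_cast
    congr 2
    ring
  · intro N M
    rw [mul_mul_mul_comm, mul_mul_mul_comm (-Complex.I), ybe_sgn_odd, neg_mul_neg,
      Complex.I_mul_I, neg_mul_neg, one_mul, one_mul, ← Complex.exp_add, ← Complex.exp_add]
    push_cast
    congr 1
    ring

theorem ybe_t4_neg (τ x : ℂ) : theta4 (-x) τ = theta4 x τ := by
  unfold theta4
  rw [← (Equiv.neg ℤ).tsum_eq]
  refine tsum_congr fun n => ?_
  simp only [Equiv.neg_apply, _root_.zpow_neg]
  rw [← _root_.inv_zpow, show ((-1 : ℂ))⁻¹ = -1 by norm_num]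
  push_cast
  congr 2
  ring

theorem ybe_t1_neg (τ x : ℂ) : theta1 (-x) τ = -theta1 x τ := by
  unfold theta1
  rw [← (Equiv.subLeft (-1 : ℤ)).tsum_eq, ← tsum_neg]
  refine tsum_congr fun n => ?_
  simp only [Equiv.subLeft_apply]
  rw [zpow_sub₀ (by norm_num)]
  have : Complex.exp ((Real.pi : ℂ) * Complex.I * (((-1 - n : ℤ) : ℂ) + 1 / 2) ^ 2 * τ +
      (2 * ((-1 - n : ℤ) : ℂ) + 1) * Complex.I * -x) =
      Complex.exp ((Real.pi : ℂ) * Complex.I * ((n : ℂ) + 1 / 2) ^ 2 * τ +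
      (2 * (n : ℂ) + 1) * Complex.I * x) := by
    push_cast
    congr 1
    ring
  rw [this]
  have h3 : (-1 : ℂ) ^ (-1 : ℤ) = -1 := by norm_num
  have h4 : ((-1 : ℂ) ^ n)⁻¹ = (-1 : ℂ) ^ n := by
    rw [← _root_.inv_zpow, show ((-1 : ℂ))⁻¹ = -1 by norm_num]
  rw [h3, div_eq_mul_inv, h4]
  ring

/-- Abstract package of what is needed about the functions `H`, `Θ`. -/
theorem ybe_HΘ (K K' : ℂ) (hτ : 0 < (Complex.I * K' / K).im) :
    ∃ A B : ℂ → ℂ, ∀ x y : ℂ,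
      ΘJ K K' x * ΘJ K K' y = A (x + y) * A (x - y) - B (x + y) * B (x - y) ∧
      HJ K K' x * HJ K K' y = A (x + y) * B (x - y) - B (x + y) * A (x - y) := by
  refine ⟨fun z => ybeA (Complex.I * K' / K) (Real.pi * z / (2 * K)),
    fun z => ybeB (Complex.I * K' / K) (Real.pi * z / (2 * K)), fun x y => ⟨?_, ?_⟩⟩
  · rw [ΘJ, ΘJ, ybe_t4t4 _ hτ]
    simp only [mul_add, mul_sub, add_div, sub_div]
  · rw [HJ, HJ, ybe_t1t1 _ hτ]
    simp only [mul_add, mul_sub, add_div, sub_div]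

theorem ybe_Θ_neg (K K' x : ℂ) : ΘJ K K' (-x) = ΘJ K K' x := by
  rw [ΘJ, ΘJ, ← ybe_t4_neg]; congr 1; ring

theorem ybe_H_neg (K K' x : ℂ) : HJ K K' (-x) = -HJ K K' x := by
  rw [HJ, HJ, ← ybe_t1_neg]; congr 1; ring

theorem ybe_P (K K' : ℂ) (hτ : 0 < (Complex.I * K' / K).im) (p x y : ℂ) :
    ΘJ K K' p * ΘJ K K' (p + x) * ΘJ K K' (p + y) * ΘJ K K' (p + x + y)
      - HJ K K' p * HJ K K' (p + x) * HJ K K' (p + y) * HJ K K' (p + x + y)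
    = ΘJ K K' 0 * ΘJ K K' (2 * p + x + y) * ΘJ K K' x * ΘJ K K' y := by
  obtain ⟨A, B, h⟩ := ybe_HΘ K K' hτ
  obtain ⟨a1, a2⟩ := h (p + x + y) p
  obtain ⟨b1, b2⟩ := h (p + x) (p + y)
  obtain ⟨c1, c2⟩ := h (2 * p + x + y) 0
  obtain ⟨d1, d2⟩ := h x y
  rw [show p + x + y + p = 2 * p + x + y by ring, show p + x + y - p = x + y by ring] at a1 a2
  rw [show p + x + (p + y) = 2 * p + x + y by ring, show p + x - (p + y) = x - y by ring] at b1 b2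
  rw [add_zero, sub_zero] at c1 c2
  have l1 : ΘJ K K' p * ΘJ K K' (p + x) * ΘJ K K' (p + y) * ΘJ K K' (p + x + y)
    = (ΘJ K K' (p + x + y) * ΘJ K K' p) * (ΘJ K K' (p + x) * ΘJ K K' (p + y)) := by ring
  have l2 : HJ K K' p * HJ K K' (p + x) * HJ K K' (p + y) * HJ K K' (p + x + y)
    = (HJ K K' (p + x + y) * HJ K K' p) * (HJ K K' (p + x) * HJ K K' (p + y)) := by ring
  have l3 : ΘJ K K' 0 * ΘJ K K' (2 * p + x + y) * ΘJ K K' x * ΘJ K K' y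
    = (ΘJ K K' (2 * p + x + y) * ΘJ K K' 0) * (ΘJ K K' x * ΘJ K K' y) := by ring
  rw [l1, l2, l3, a1, a2, b1, b2, c1, d1]
  ring

theorem ybe_Q (K K' : ℂ) (hτ : 0 < (Complex.I * K' / K).im) (p x y : ℂ) :
    ΘJ K K' p * HJ K K' (p + x) * HJ K K' (p + y) * ΘJ K K' (p + x + y)
      - HJ K K' p * ΘJ K K' (p + x) * ΘJ K K' (p + y) * HJ K K' (p + x + y)
    = ΘJ K K' 0 * ΘJ K K' (2 * p + x + y) * HJ K K' x * HJ K K' y := by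
  obtain ⟨A, B, h⟩ := ybe_HΘ K K' hτ
  obtain ⟨a1, a2⟩ := h (p + x + y) p
  obtain ⟨b1, b2⟩ := h (p + x) (p + y)
  obtain ⟨c1, c2⟩ := h (2 * p + x + y) 0
  obtain ⟨d1, d2⟩ := h x y
  rw [show p + x + y + p = 2 * p + x + y by ring, show p + x + y - p = x + y by ring] at a1 a2
  rw [show p + x + (p + y) = 2 * p + x + y by ring, show p + x - (p + y) = x - y by ring] at b1 b2
  rw [add_zero, sub_zero] at c1 c2
  have l1 : ΘJ K K' p * HJ K K' (p + x) * HJ K K' (p + y) * ΘJ K K' (p + x + y)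
    = (ΘJ K K' (p + x + y) * ΘJ K K' p) * (HJ K K' (p + x) * HJ K K' (p + y)) := by ring
  have l2 : HJ K K' p * ΘJ K K' (p + x) * ΘJ K K' (p + y) * HJ K K' (p + x + y)
    = (HJ K K' (p + x + y) * HJ K K' p) * (ΘJ K K' (p + x) * ΘJ K K' (p + y)) := by ring
  have l3 : ΘJ K K' 0 * ΘJ K K' (2 * p + x + y) * HJ K K' x * HJ K K' y
    = (ΘJ K K' (2 * p + x + y) * ΘJ K K' 0) * (HJ K K' x * HJ K K' y) := by ring
  rw [l1, l2, l3, a1, a2, b1, b2, c1, d2]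
  ring

/- ### Local relation, abstractly -/

def ybeR (a b c d : ℂ) : Matrix (Fin 2 × Fin 2) (Fin 2 × Fin 2) ℂ :=
  Matrix.of fun p q =>
    if p = q then (if p.1 = p.2 then a else b)
    else if q = (p.2, p.1) ∧ p.1 ≠ p.2 then c
    else if p.1 = p.2 ∧ q.1 = q.2 then d
    else 0

def ybeL (a b c d : ℂ) : Matrix (Fin 2) (Fin 2) (Matrix (Fin 2) (Fin 2) ℂ) :=
  !![!![a, 0; 0, b], !![0, d; c, 0]; !![0, c; d, 0], !![b, 0; 0, a]]

theorem ybe_Lsite (K K' η μ : ℂ) : Lsite K K' η μ =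
    ybeL (w4p3 K K' η μ) (w4m3 K K' η μ) (w1p2 K K' η μ) (w1m2 K K' η μ) := by
  have hI : Complex.I * Complex.I = -1 := Complex.I_mul_I
  ext i j k l
  fin_cases i <;> fin_cases j <;> fin_cases k <;> fin_cases l <;>
    simp [Lsite, ybeL, σx, σy, σz, wc1, wc2, wc3, wc4] <;> try ring_nf
  all_goals try simp only [Complex.I_sq]
  all_goals try ring

set_option maxHeartbeats 4000000 in
theorem ybe_local (a b c d a1 b1 c1 d1 a2 b2 c2 d2 : ℂ)
    (h1 : a * c1 * a2 + d * a1 * d2 = b * c1 * b2 + c * a1 * c2)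
    (h2 : a * b1 * c2 + d * d1 * b2 = b * a1 * c2 + c * c1 * b2)
    (h3 : c * b1 * a2 + b * d1 * d2 = c * a1 * b2 + b * c1 * c2)
    (h4 : a * d1 * b2 + d * b1 * c2 = b * d1 * a2 + c * b1 * d2)
    (h5 : a * a1 * d2 + d * c1 * a2 = b * b1 * d2 + c * d1 * a2)
    (h6 : d * a1 * a2 + a * c1 * d2 = d * b1 * b2 + a * d1 * c2) :
    (ybeR a c b d).map (fun z => z • (1 : Matrix (Fin 2) (Fin 2) ℂ)) *
        (ybeL a1 b1 c1 d1 ⊗ₖ ybeL a2 b2 c2 d2) =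
      (ybeL a2 b2 c2 d2 ⊗ₖ ybeL a1 b1 c1 d1) *
        (ybeR a c b d).map (fun z => z • (1 : Matrix (Fin 2) (Fin 2) ℂ)) := by
  ext ⟨i, j⟩ ⟨k, l⟩ m n
  fin_cases i <;> fin_cases j <;> fin_cases k <;> fin_cases l <;>
    fin_cases m <;> fin_cases n <;>
    simp [ybeR, ybeL, Matrix.mul_apply, Fintype.sum_prod_type, Matrix.kroneckerMap_apply]
  all_goals first
    | ring1
    | linear_combination h1
    | linear_combination -h1
    | linear_combination h2
    | linear_combination -h2
    | linear_combination h3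
    | linear_combination -h3
    | linear_combination h4
    | linear_combination -h4
    | linear_combination h5
    | linear_combination -h5
    | linear_combination h6
    | linear_combination -h6

theorem ybe_S (K K' : ℂ) (hτ : 0 < (Complex.I * K' / K).im) (p x y : ℂ) :
    ΘJ K K' p * ΘJ K K' (p + x) * HJ K K' (p + y) * HJ K K' (p + x + y)
      - HJ K K' p * HJ K K' (p + x) * ΘJ K K' (p + y) * ΘJ K K' (p + x + y)
    = ΘJ K K' 0 * ΘJ K K' x * HJ K K' y * HJ K K' (2 * p + x + y) := by
  have h := ybe_Q K K' hτ (-p) (-y) (2 * p + x + y)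
  rw [show -p + -y = -(p + y) by ring, show -p + (2 * p + x + y) = p + x + y by ring,
    show -(p + y) + (2 * p + x + y) = p + x by ring,
    show 2 * -p + -y + (2 * p + x + y) = x by ring,
    ybe_H_neg, ybe_H_neg, ybe_H_neg, ybe_Θ_neg, ybe_Θ_neg] at h
  linear_combination -h

set_option maxHeartbeats 1000000 in
theorem ybe_six (K K' η : ℂ) (hτ : 0 < (Complex.I * K' / K).im) (lam mu : ℂ) :
    (Rc K K' η lam mu).map (fun z => z • (1 : Matrix (Fin 2) (Fin 2) ℂ)) *
        (Lsite K K' η lam ⊗ₖ Lsite K K' η mu) =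
      (Lsite K K' η mu ⊗ₖ Lsite K K' η lam) *
        (Rc K K' η lam mu).map (fun z => z • (1 : Matrix (Fin 2) (Fin 2) ℂ)) := by
  obtain ⟨e, he⟩ : ∃ e, e = 2 * η := ⟨_, rfl⟩
  obtain ⟨u, hu⟩ : ∃ u, u = lam - mu := ⟨_, rfl⟩
  obtain ⟨v, hv⟩ : ∃ v, v = mu - η := ⟨_, rfl⟩
  have e1 : mu + η = v + e := by rw [hv, he]; ring
  have e2 : lam - η = u + v := by rw [hu, hv]; ring
  have e3 : lam + η = u + v + e := by rw [hu, hv, he]; ring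
  have hR : Rc K K' η lam mu = ybeR (aJ K K' η lam mu) (bJ K K' η lam mu) (cJ K K' η lam mu)
    (dJ K K' η lam mu) := rfl
  rw [hR, ybe_Lsite, ybe_Lsite]
  have p1 := ybe_P K K' hτ u (v - u) e
  have s1 := ybe_S K K' hτ u (v - u) e
  have p2 := ybe_P K K' hτ u e v
  have q2 := ybe_Q K K' hτ u e v
  have p3 := ybe_P K K' hτ v e u
  have q3 := ybe_Q K K' hτ v e u
  have q4 := ybe_Q K K' hτ u (v - u) e
  have s4 := ybe_S K K' hτ u e (v - u)
  have s5 := ybe_S K K' hτ u v e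
  have t5 := ybe_S K K' hτ u e v
  have s6 := ybe_S K K' hτ v u e
  have t6 := ybe_S K K' hτ v e u
  have f1 : u + (v - u) = v := by ring
  have f2 : u + e + (v - u) = v + e := by ring
  have f3 : u + e + v = u + v + e := by ring
  have f4 : v + e + u = u + v + e := by ring
  have f5 : v + u = u + v := by ring
  have f6 : 2 * u + (v - u) + e = u + v + e := by ring
  have f7 : 2 * u + e + (v - u) = u + v + e := by ring
  have f8 : 2 * u + e + v = 2 * u + v + e := by ring
  have f9 : 2 * v + e + u = 2 * v + u + e := by ring
  simp only [f1, f2, f3, f4, f5, f6, f7, f8, f9] at p1 s1 p2 q2 p3 q3 q4 s4 s5 t5 s6 t6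
  apply ybe_local <;>
    simp only [aJ, bJ, cJ, dJ, w4p3, w4m3, w1p2, w1m2, ← he, ← hu, ← hv, e1, e2, e3]
  · linear_combination HJ K K' e * ΘJ K K' e * ΘJ K K' (u + v) *
      (ΘJ K K' e * ΘJ K K' (u + v + e) * s1 - HJ K K' e * HJ K K' (u + v + e) * p1)
  · linear_combination HJ K K' e * ΘJ K K' e * ΘJ K K' (v + e) *
      (ΘJ K K' e * ΘJ K K' v * q2 - HJ K K' e * HJ K K' v * p2)
  · linear_combination HJ K K' e * ΘJ K K' e * ΘJ K K' (u + e) *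
      (ΘJ K K' e * ΘJ K K' u * q3 - HJ K K' e * HJ K K' u * p3)
  · linear_combination HJ K K' e * ΘJ K K' e * HJ K K' (u + v) *
      (ΘJ K K' e * HJ K K' (u + v + e) * q4 - HJ K K' e * ΘJ K K' (u + v + e) * s4)
  · linear_combination HJ K K' e * ΘJ K K' e * HJ K K' (v + e) *
      (ΘJ K K' e * HJ K K' v * s5 - HJ K K' e * ΘJ K K' v * t5)
  · linear_combination HJ K K' e * ΘJ K K' e * HJ K K' (u + e) *
      (ΘJ K K' e * HJ K K' u * s6 - HJ K K' e * ΘJ K K' u * t6)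

end Helpers

section Helpers2

/- ### The embedding -/

theorem ybe_embed_mul_apply (L : ℕ) (n : Fin L) (A : Matrix (Fin 2) (Fin 2) ℂ) (M : OpC L)
    (f g : Conf L) :
    (embed L n A * M) f g = ∑ i, A (f n) i * M (Function.update f n i) g := by
  rw [Matrix.mul_apply]
  symm
  refine Finset.sum_of_injOn (fun i => Function.update f n i) ?_ ?_ ?_ ?_
  · intro i _ j _ h
    simpa using congrFun h n
  · intro i _; simp
  · intro k _ hk
    have : ∃ m ∈ univ.erase n, f m ≠ k m := by
      by_contra hcon
      push Not at hcon
      apply hk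
      refine ⟨k n, by simp, ?_⟩
      funext m
      by_cases hm : m = n
      · subst hm; simp
      · simp only [Function.update_of_ne hm]
        exact hcon m (by simp [hm])
    obtain ⟨m, hm, hne⟩ := this
    have : (∏ m ∈ univ.erase n, if f m = k m then (1 : ℂ) else 0) = 0 :=
      Finset.prod_eq_zero hm (by simp [hne])
    simp [embed, this]
  · intro i _
    have : (∏ m ∈ univ.erase n, if f m = Function.update f n i m then (1 : ℂ) else 0) = 1 := by
      refine Finset.prod_eq_one fun m hm => ?_
      rw [Function.update_of_ne (Finset.ne_of_mem_erase hm)]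
      simp
    simp [embed, this]

theorem ybe_embed_one (L : ℕ) (n : Fin L) : embed L n 1 = 1 := by
  have h : ∀ f g, (embed L n 1 * (1 : OpC L)) f g = (1 : OpC L) f g := by
    intro f g
    rw [ybe_embed_mul_apply, Finset.sum_eq_single (f n)]
    · rw [Function.update_eq_self, Matrix.one_apply_eq, one_mul]
    · intro b _ hb
      simp [Matrix.one_apply, hb.symm]
    · simp
  ext f g
  simpa using h f g

theorem ybe_embed_mul (L : ℕ) (n : Fin L) (A B : Matrix (Fin 2) (Fin 2) ℂ) :
    embed L n (A * B) = embed L n A * embed L n B := by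
  have h : ∀ f g, (embed L n (A * B) * (1 : OpC L)) f g
      = (embed L n A * (embed L n B * (1 : OpC L))) f g := by
    intro f g
    simp only [ybe_embed_mul_apply, Function.update_self, Finset.mul_sum]
    rw [Finset.sum_comm]
    refine Finset.sum_congr rfl fun i _ => ?_
    rw [Matrix.mul_apply, Finset.sum_mul]
    refine Finset.sum_congr rfl fun j _ => ?_
    rw [Function.update_idem, mul_assoc]
  ext f g
  simpa using h f g

theorem ybe_embed_comm (L : ℕ) (n m : Fin L) (hnm : n ≠ m) (A B : Matrix (Fin 2) (Fin 2) ℂ) :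
    embed L n A * embed L m B = embed L m B * embed L n A := by
  have h : ∀ f g, (embed L n A * (embed L m B * (1 : OpC L))) f g
      = (embed L m B * (embed L n A * (1 : OpC L))) f g := by
    intro f g
    simp only [ybe_embed_mul_apply, Function.update_of_ne hnm, Function.update_of_ne hnm.symm,
      Finset.mul_sum]
    rw [Finset.sum_comm]
    refine Finset.sum_congr rfl fun i _ => Finset.sum_congr rfl fun j _ => ?_
    rw [Function.update_comm hnm]
    ring
  ext f g
  simpa using h f g

def ybeHom (L : ℕ) (n : Fin L) : Matrix (Fin 2) (Fin 2) ℂ →+* OpC L where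
  toFun := embed L n
  map_one' := ybe_embed_one L n
  map_mul' := ybe_embed_mul L n
  map_zero' := by ext f g; simp [embed]
  map_add' A B := by ext f g; simp [embed, add_mul]

theorem ybe_embed_smul (L : ℕ) (n : Fin L) (z : ℂ) :
    embed L n (z • 1) = z • (1 : OpC L) := by
  rw [← ybe_embed_one L n]
  ext f g
  simp [embed, mul_assoc]

/- ### Gluing -/

theorem ybe_kron_mul {S : Type*} [Ring S] (X Y X' Y' : Matrix (Fin 2) (Fin 2) S)
    (h : ∀ i j k l, Commute (Y i j) (X' k l)) :
    (X * Y) ⊗ₖ (X' * Y') = (X ⊗ₖ X') * (Y ⊗ₖ Y') := by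
  ext ⟨i, j⟩ ⟨k, l⟩
  simp only [Matrix.kroneckerMap_apply, Matrix.mul_apply, Fintype.sum_prod_type,
    Finset.sum_mul_sum]
  refine Finset.sum_congr rfl fun a _ => Finset.sum_congr rfl fun b _ => ?_
  rw [mul_assoc, ← mul_assoc (Y a k), (h a k j b).eq]
  simp only [mul_assoc]

theorem ybe_comm_prod {S ι : Type*} [Ring S] (s : S) (l : List ι)
    (X : ι → Matrix (Fin 2) (Fin 2) S) (h : ∀ n ∈ l, ∀ i j, Commute (X n i j) s) :
    ∀ i j, Commute ((l.map X).prod i j) s := by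
  induction l with
  | nil =>
    intro i j
    simp only [List.map_nil, List.prod_nil, Matrix.one_apply]
    split_ifs
    · exact Commute.one_left s
    · exact Commute.zero_left s
  | cons n l ih =>
    intro i j
    rw [List.map_cons, List.prod_cons, Matrix.mul_apply]
    refine Commute.sum_left _ _ _ fun k _ => ?_
    exact (h n (by simp) i k).mul_left (ih (fun m hm => h m (by simp [hm])) k j)

theorem ybe_glue {S ι : Type*} [Ring S] (R : Matrix (Fin 2 × Fin 2) (Fin 2 × Fin 2) S)
    (X Y : ι → Matrix (Fin 2) (Fin 2) S) (l : List ι) (hl : l.Nodup)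
    (hXY : ∀ m n, m ≠ n → ∀ i j k l, Commute (X m i j) (Y n k l))
    (hR : ∀ n, R * (X n ⊗ₖ Y n) = (Y n ⊗ₖ X n) * R) :
    R * ((l.map X).prod ⊗ₖ (l.map Y).prod) = ((l.map Y).prod ⊗ₖ (l.map X).prod) * R := by
  induction l with
  | nil => simp
  | cons n l ih =>
    obtain ⟨hn, hl'⟩ := List.nodup_cons.1 hl
    simp only [List.map_cons, List.prod_cons]
    rw [ybe_kron_mul, ybe_kron_mul, ← mul_assoc, hR, mul_assoc, ih hl', mul_assoc]
    · intro i j k k'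
      exact ybe_comm_prod _ _ _ (fun m hm i j =>
        (hXY n m (fun e => hn (e ▸ hm)) _ _ _ _).symm) i j
    · intro i j k k'
      exact ybe_comm_prod _ _ _ (fun m hm i j =>
        (hXY m n (fun e => hn (e ▸ hm)) _ _ _ _)) i j

end Helpers2

/-- the global Yang–Baxter equation for the monodromy matrix
`R(λ,μ)·(T(λ) ⊗ T(μ)) = (T(μ) ⊗ T(λ))·R(λ,μ)`, as an identity of 4×4 matrices with
entries operators on (ℂ²)^{⊗L}. -/
theorem xyz_global_yang_baxter (K K' η : ℂ) (hτ : 0 < (Complex.I * K' / K).im)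
    (L : ℕ) (lam mu : ℂ) :
    (Rc K K' η lam mu).map (fun z => z • (1 : OpC L)) *
        (Tm K K' η L lam ⊗ₖ Tm K K' η L mu) =
      (Tm K K' η L mu ⊗ₖ Tm K K' η L lam) *
        (Rc K K' η lam mu).map (fun z => z • (1 : OpC L)) := by
  have hT : ∀ ν : ℂ, Tm K K' η L ν =
      ((List.ofFn (Fin.rev : Fin L → Fin L)).map fun n => Lop K K' η L n ν).prod := by
    intro ν
    rw [Tm, List.map_ofFn]
    rfl
  rw [hT, hT]
  refine ybe_glue _ (fun n => Lop K K' η L n lam) (fun n => Lop K K' η L n mu) _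
    (List.nodup_ofFn.2 Fin.rev_injective) ?_ ?_
  · intro m n hmn i j k l
    exact ybe_embed_comm L m n hmn _ _
  · intro n
    have hk : ∀ X Y : Matrix (Fin 2) (Fin 2) (Matrix (Fin 2) (Fin 2) ℂ),
        (X.map (embed L n)) ⊗ₖ (Y.map (embed L n)) = (X ⊗ₖ Y).map (ybeHom L n) := by
      intro X Y
      ext1 ⟨i, j⟩ ⟨k, l⟩
      exact (ybe_embed_mul L n _ _).symm
    have hr : (Rc K K' η lam mu).map (fun z => z • (1 : OpC L)) =
        ((Rc K K' η lam mu).map (fun z => z • (1 : Matrix (Fin 2) (Fin 2) ℂ))).map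
          (ybeHom L n) := by
      ext1 p q
      exact (ybe_embed_smul L n _).symm
    simp only [Lop]
    rw [hk, hk, hr, ← Matrix.map_mul, ← Matrix.map_mul, ybe_six K K' η hτ]

end
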